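/- In the lattice L = U ⊕ U ⊕ U ⊕ E8 ⊕ E8 ⊕ ⟨−2⟩, let (e,f) be the standard basis of the first U-factor and δ a generator of the ⟨−2⟩-factor, and set v = 2e + 12f + δ. Then v is a primitive vector with ⟨v,v⟩ = 46, and the orthogonal complement v^⊥ = {x ∈ L : ⟨x,v⟩ = 0}, with the restricted bilinear form, is isometric to the lattice U ⊕ U ⊕ E8 ⊕ E8 ⊕ K₂₃. -/

import Mathlib

open Matrix

/-- Gram matrix of the hyperbolic plane `U`. -/
def latU : Matrix (Fin 2) (Fin 2) ℤ := !![0, 1; 1, 0]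

/-- Gram matrix of the negative definite `E8` lattice (diagonal `-2`, entry `1` for
vertices adjacent in the `E8` Dynkin diagram). -/
def latE8 : Matrix (Fin 8) (Fin 8) ℤ :=
  !![-2,  0,  1,  0,  0,  0,  0,  0;
      0, -2,  0,  1,  0,  0,  0,  0;
      1,  0, -2,  1,  0,  0,  0,  0;
      0,  1,  1, -2,  1,  0,  0,  0;
      0,  0,  0,  1, -2,  1,  0,  0;
      0,  0,  0,  0,  1, -2,  1,  0;
      0,  0,  0,  0,  0,  1, -2,  1;
      0,  0,  0,  0,  0,  0,  1, -2]

/-- Gram matrix of the lattice `K₂₃`. -/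
def latK23 : Matrix (Fin 2) (Fin 2) ℤ := !![-12, 1; 1, -2]

/-- Gram matrix of the lattice `S = U ⊕ U ⊕ E8 ⊕ E8 ⊕ K₂₃` of signature `(2, 20)`. -/
def gramS : Matrix (Fin 22) (Fin 22) ℤ :=
  Matrix.reindex
    (((((finSumFinEquiv.sumCongr (Equiv.refl (Fin 8))).trans
          finSumFinEquiv).sumCongr (Equiv.refl (Fin 8))).trans
          finSumFinEquiv).sumCongr (Equiv.refl (Fin 2)) |>.trans finSumFinEquiv)
    (((((finSumFinEquiv.sumCongr (Equiv.refl (Fin 8))).trans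
          finSumFinEquiv).sumCongr (Equiv.refl (Fin 8))).trans
          finSumFinEquiv).sumCongr (Equiv.refl (Fin 2)) |>.trans finSumFinEquiv)
    (Matrix.fromBlocks
      (Matrix.fromBlocks
        (Matrix.fromBlocks (Matrix.fromBlocks latU 0 0 latU) 0 0 latE8) 0 0 latE8)
      0 0 latK23)

/-- Reindexing equivalence used to assemble the Gram matrix of `L`.
The standard basis `(e, f)` of the first `U`-factor sits at indices `0, 1` and the
generator `δ` of the `⟨-2⟩`-factor at index `22`. -/
def eqL : (((((Fin 2 ⊕ Fin 2) ⊕ Fin 2) ⊕ Fin 8) ⊕ Fin 8) ⊕ Fin 1) ≃ Fin 23 :=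
  (Equiv.sumCongr
    ((Equiv.sumCongr
      ((Equiv.sumCongr
        ((Equiv.sumCongr finSumFinEquiv (Equiv.refl (Fin 2))).trans finSumFinEquiv)
        (Equiv.refl (Fin 8))).trans finSumFinEquiv)
      (Equiv.refl (Fin 8))).trans finSumFinEquiv)
    (Equiv.refl (Fin 1))).trans finSumFinEquiv

/-- Gram matrix of the lattice `L = U ⊕ U ⊕ U ⊕ E8 ⊕ E8 ⊕ ⟨-2⟩` of signature `(3, 20)`. -/
def gramL : Matrix (Fin 23) (Fin 23) ℤ :=
  Matrix.reindex eqL eqL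
    (Matrix.fromBlocks
      (Matrix.fromBlocks
        (Matrix.fromBlocks
          (Matrix.fromBlocks (Matrix.fromBlocks latU 0 0 latU) 0 0 latU) 0 0 latE8)
        0 0 latE8)
      0 0 !![-2])

/-- The vector `v = 2e + 12f + δ` in `L`. -/
def vecV : Fin 23 → ℤ := fun i => if i = 0 then 2 else if i = 1 then 12 else if i = 22 then 1 else 0

/-- A basis of `v^⊥` with Gram matrix `gramS`: the standard basis vectors of the summands
`U ⊕ U ⊕ E8 ⊕ E8` of `L`, followed by `e - 6f` and `f + δ`. -/
def orthBasis (i : Fin 22) : Fin 23 → ℤ :=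
  if i = 20 then Pi.single 0 1 - 6 • Pi.single 1 1
  else if i = 21 then Pi.single 1 1 + Pi.single 22 1
  else Pi.single (i.castSucc + 2) 1

/-- Coordinates, with respect to `orthBasis`, of a vector of `v^⊥`. -/
def orthCoord (x : Fin 23 → ℤ) (i : Fin 22) : ℤ :=
  if i = 20 then x 0 else if i = 21 then x 22 else x (i.castSucc + 2)

theorem vecMul_gramL_vecV :
    vecV ᵥ* gramL = Pi.single 0 12 + Pi.single 1 2 - Pi.single 22 2 := by
  decide +kernel

theorem vecV_dotProduct_gramL (x : Fin 23 → ℤ) :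
    vecV ⬝ᵥ gramL.mulVec x = 12 * x 0 + 2 * x 1 - 2 * x 22 := by
  rw [dotProduct_mulVec, vecMul_gramL_vecV]
  simp [add_dotProduct, sub_dotProduct]

theorem orthBasis_gram :
    (of fun i j => orthBasis i ⬝ᵥ gramL.mulVec (orthBasis j)) = gramS := by
  decide +kernel

theorem orthCoord_orthBasis : ∀ i j, orthCoord (orthBasis i) j = if i = j then 1 else 0 := by
  decide +kernel

theorem orthCoord_sum (c : Fin 22 → ℤ) : orthCoord (∑ i, c i • orthBasis i) = c := by
  funext j
  have h : orthCoord (∑ i, c i • orthBasis i) j = ∑ i, c i * orthCoord (orthBasis i) j := by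
    unfold orthCoord
    split_ifs <;> simp [-zsmul_eq_mul]
  rw [h]
  simp [orthCoord_orthBasis]

theorem eq_of_orthCoord_eq {x y : Fin 23 → ℤ} (hx : vecV ⬝ᵥ gramL.mulVec x = 0)
    (hy : vecV ⬝ᵥ gramL.mulVec y = 0) (h : orthCoord x = orthCoord y) : x = y := by
  rw [vecV_dotProduct_gramL] at hx hy
  have h0 : x 0 = y 0 := congrFun h 20
  have h22 : x 22 = y 22 := congrFun h 21
  have h1 : x 1 = y 1 := by lia
  funext j
  by_cases hj0 : j = 0
  · rwa [hj0]
  by_cases hj1 : j = 1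
  · rwa [hj1]
  by_cases hj22 : j = 22
  · rwa [hj22]
  obtain ⟨i, h20, h21, rfl⟩ :
      ∃ i : Fin 22, i ≠ 20 ∧ i ≠ 21 ∧ i.castSucc + 2 = j := by
    revert j
    decide +kernel
  simpa [orthCoord, h20, h21] using congrFun h i

theorem orthBasis_mem : ∀ i, vecV ⬝ᵥ gramL.mulVec (orthBasis i) = 0 := by
  decide +kernel

theorem sum_orthBasis_mem (c : Fin 22 → ℤ) :
    vecV ⬝ᵥ gramL.mulVec (∑ i, c i • orthBasis i) = 0 := by
  simp [mulVec_sum, dotProduct_sum, mulVec_smul, orthBasis_mem, -zsmul_eq_mul]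

/-- In `L = U ⊕ U ⊕ U ⊕ E8 ⊕ E8 ⊕ ⟨-2⟩`, the vector `v = 2e + 12f + δ`
is primitive of square `46`, and its orthogonal complement is isometric to
`U ⊕ U ⊕ E8 ⊕ E8 ⊕ K₂₃`. -/
theorem stmt14 :
    (∀ (m : ℤ) (w : Fin 23 → ℤ), vecV = m • w → IsUnit m) ∧
    vecV ⬝ᵥ gramL.mulVec vecV = 46 ∧
    ∃ b : Fin 22 → (Fin 23 → ℤ),
      (∀ i, vecV ⬝ᵥ gramL.mulVec (b i) = 0) ∧
      (∀ x : Fin 23 → ℤ, vecV ⬝ᵥ gramL.mulVec x = 0 ↔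
        ∃ c : Fin 22 → ℤ, x = ∑ i, c i • b i) ∧
      (∀ c : Fin 22 → ℤ, ∑ i, c i • b i = 0 → c = 0) ∧
      (∀ i j, b i ⬝ᵥ gramL.mulVec (b j) = gramS i j) := by
  refine ⟨fun m w h => ?_, by decide +kernel, orthBasis, orthBasis_mem, fun x => ⟨fun hx => ?_, ?_⟩,
    fun c hc => ?_, fun i j => congrFun₂ orthBasis_gram i j⟩
  · exact IsUnit.of_mul_eq_one (w 22) (congrFun h 22).symm
  · exact ⟨orthCoord x, eq_of_orthCoord_eq hx (sum_orthBasis_mem _) (orthCoord_sum _).symm⟩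
  · rintro ⟨c, rfl⟩
    exact sum_orthBasis_mem c
  · rw [← orthCoord_sum c, hc]
    funext i
    simp [orthCoord]
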